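/- Spectral bound for the linearized 2D Navier–Stokes operator 𝓛 − αΛ on Gaussian-weighted spaces. Let α ∈ ℝ, 𝓛 = Δ_ξ + (1/2)ξ·∇_ξ + 1, and Λf = g·∇_ξ f − ((−Δ_ξ)^{−1}∇_ξ^⊥ f)·∇_ξ G acting on scalar functions on ℝ², where g(ξ) = (1/(2π))(ξ^⊥/|ξ|²)(1−e^{−|ξ|²/4}), G(ξ) = (1/(4π))e^{−|ξ|²/4}, and (−Δ_ξ)^{−1}∇_ξ^⊥ is convolution with the kernel −(1/(2π)) ξ^⊥/|ξ|². Suppose f : ℝ² → ℂ is smooth with ξ^k∇_ξ^ℓ f ∈ L²_ξ(∞) for all integers k, ℓ ≥ 0, f ≠ 0, and (𝓛 − αΛ)f = λf for some λ ∈ ℂ. Then Re λ ≤ 0. If moreover ∫_{ℝ²} f dξ = 0, then Re λ ≤ −1/2. -/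

import Mathlib

/-!
Spectral bound for the linearized 2D Navier–Stokes operator `𝓛 − αΛ` on
Gaussian-weighted spaces: eigenvalues with Gaussian-decaying eigenfunctions
satisfy `Re λ ≤ 0`, and `Re λ ≤ −1/2` if the eigenfunction has zero mean.
-/

open MeasureTheory Real
open scoped ENNReal

noncomputable section

abbrev R2 : Type := EuclideanSpace ℝ (Fin 2)

def v2 (a b : ℝ) : R2 := (WithLp.equiv 2 (Fin 2 → ℝ)).symm ![a, b]
def e2 (i : Fin 2) : R2 := EuclideanSpace.single i 1

/-- `g(ξ) = (1/2π)(ξ^⊥/|ξ|²)(1−e^{−|ξ|²/4})`. -/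
def gvec (ξ : R2) : R2 :=
  ((2 * π)⁻¹ * ‖ξ‖^(-(2:ℝ)) * (1 - Real.exp (-‖ξ‖^2/4))) • v2 (-(ξ 1)) (ξ 0)

/-- `G(ξ) = (1/4π) e^{−|ξ|²/4}`. -/
def Gval (ξ : R2) : ℝ := (4 * π)⁻¹ * Real.exp (-‖ξ‖^2/4)

/-- the Fokker–Planck operator `𝓛 = Δ + (1/2)ξ·∇ + 1` on scalar complex functions. -/
def FP (f : R2 → ℂ) (ξ : R2) : ℂ :=
  (∑ i : Fin 2, fderiv ℝ (fun w => fderiv ℝ f w (e2 i)) ξ (e2 i))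
    + (1/2 : ℝ) • fderiv ℝ f ξ ξ + f ξ

/-- `(−Δ)⁻¹∇^⊥ f`, convolution with the kernel `−(1/2π) ξ^⊥/|ξ|²`
(componentwise, for complex scalar `f`). -/
def BSvel (f : R2 → ℂ) (ξ : R2) (i : Fin 2) : ℂ :=
  ∫ η : R2, f η * ((-(2*π)⁻¹ * ‖ξ - η‖^(-(2:ℝ)) * (v2 (-((ξ - η) 1)) ((ξ - η) 0)) i : ℝ) : ℂ)

/-- `Λ f = g·∇f − ((−Δ)⁻¹∇^⊥f)·∇G`, with `∇G(ξ) = −(ξ/2)G(ξ)`. -/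
def LambdaOp (f : R2 → ℂ) (ξ : R2) : ℂ :=
  fderiv ℝ f ξ (gvec ξ)
    - (BSvel f ξ 0 * ((-(ξ 0)/2 * Gval ξ : ℝ) : ℂ)
       + BSvel f ξ 1 * ((-(ξ 1)/2 * Gval ξ : ℝ) : ℂ))

/-- Gaussian decay: `ξ^k ∇^ℓ f ∈ L²_ξ(∞)` for all `k, ℓ`. -/
def GaussianDecay (f : R2 → ℂ) : Prop :=
  ∀ k l : ℕ,
    (∫⁻ ξ : R2, ENNReal.ofReal
      (‖ξ‖^(2*k) * ‖iteratedFDeriv ℝ l f ξ‖^2 * Real.exp (‖ξ‖^2/4))) < ⊤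

section Poincare

open ProbabilityTheory

/-- The centered Gaussian measure of variance `2` on `ℝ`. -/
def stdγ : Measure ℝ := gaussianReal 0 2

instance : IsProbabilityMeasure stdγ := by unfold stdγ; infer_instance


lemma hasDerivAt_pdf (t : ℝ) :
    HasDerivAt (gaussianPDFReal 0 2) (-(t / 2) * gaussianPDFReal 0 2 t) t := by
  have h : HasDerivAt (fun x : ℝ => -(x - 0) ^ 2 / (2 * (2 : NNReal))) (-(t / 2)) t := by
    have := (((hasDerivAt_id t).sub_const 0).pow 2).neg.div_const (2 * ((2 : NNReal) : ℝ))
    refine this.congr_deriv ?_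
    simp; ring
  refine (h.exp.const_mul (√(2 * π * (2 : NNReal)))⁻¹).congr_deriv ?_
  simp only [gaussianPDFReal]; ring

lemma tendsto_pdf_cocompact :
    Filter.Tendsto (gaussianPDFReal 0 2) (Filter.cocompact ℝ) (nhds 0) := by
  have h1 := tendsto_rpow_abs_mul_exp_neg_mul_sq_cocompact (a := 1 / 4) (by norm_num) 0
  have h2 := h1.const_mul (√(2 * π * (2 : NNReal)))⁻¹
  rw [mul_zero] at h2
  refine h2.congr fun x => ?_
  simp only [gaussianPDFReal, rpow_zero, one_mul]
  congr 2
  simp; ring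

lemma integrable_id_stdγ : Integrable (fun x : ℝ => x) stdγ :=
  (memLp_id_gaussianReal (μ := 0) (v := 2) 1).integrable le_rfl

lemma setIntegral_stdγ (s : Set ℝ) (hs : MeasurableSet s) :
    ∫ x in s, x ∂stdγ = ∫ x in s, x * gaussianPDFReal 0 2 x := by
  rw [stdγ, gaussianReal_of_var_ne_zero _ (by norm_num),
    setIntegral_withDensity_eq_setIntegral_toReal_smul (measurable_gaussianPDF _ _)
      (by simp [gaussianPDF]) _ hs]
  simp [toReal_gaussianPDF, mul_comm]

lemma integrable_mul_pdf : Integrable (fun x : ℝ => x * gaussianPDFReal 0 2 x) := by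
  have h := integrable_id_stdγ
  rw [stdγ, gaussianReal_of_var_ne_zero _ (by norm_num),
    integrable_withDensity_iff_integrable_smul' (measurable_gaussianPDF _ _)
      (by simp [gaussianPDF])] at h
  simpa [toReal_gaussianPDF, mul_comm] using h

lemma setIntegral_Ioi_id_stdγ (t : ℝ) :
    ∫ x in Set.Ioi t, x ∂stdγ = 2 * gaussianPDFReal 0 2 t := by
  rw [setIntegral_stdγ _ measurableSet_Ioi,
    integral_Ioi_of_hasDerivAt_of_tendsto' (f := fun x => -2 * gaussianPDFReal 0 2 x) (m := 0)]
  · ring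
  · intro x _
    exact ((hasDerivAt_pdf x).const_mul (-2)).congr_deriv (by ring)
  · exact integrable_mul_pdf.integrableOn
  · simpa using (tendsto_pdf_cocompact.mono_left atTop_le_cocompact).const_mul (-2)

lemma setIntegral_Iic_id_stdγ (t : ℝ) :
    ∫ x in Set.Iic t, x ∂stdγ = -(2 * gaussianPDFReal 0 2 t) := by
  rw [setIntegral_stdγ _ measurableSet_Iic,
    integral_Iic_of_hasDerivAt_of_tendsto' (f := fun x => -2 * gaussianPDFReal 0 2 x) (m := 0)]
  · ring
  · intro x _
    exact ((hasDerivAt_pdf x).const_mul (-2)).congr_deriv (by ring)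
  · exact integrable_mul_pdf.integrableOn
  · simpa using (tendsto_pdf_cocompact.mono_left atBot_le_cocompact).const_mul (-2)

lemma lintegral_posPart_stdγ (t : ℝ) :
    ∫⁻ y, ENNReal.ofReal (y - t) ∂stdγ
      = ENNReal.ofReal (2 * gaussianPDFReal 0 2 t - t * stdγ.real (Set.Ioi t)) := by
  have h0 : (fun y => ENNReal.ofReal (y - t))
      = (Set.Ioi t).indicator (fun y => ENNReal.ofReal (y - t)) := by
    ext y
    by_cases h : t < y
    · simp [h]
    · simp [h, not_lt.mp h]
  have hi : Integrable (fun y => y - t) stdγ := integrable_id_stdγ.sub (integrable_const t)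
  rw [h0, lintegral_indicator measurableSet_Ioi, ← ofReal_integral_eq_lintegral_ofReal hi.integrableOn]
  · rw [integral_sub integrable_id_stdγ.integrableOn (integrable_const t), setIntegral_Ioi_id_stdγ]
    simp [mul_comm]
  · filter_upwards [ae_restrict_mem measurableSet_Ioi] with y hy
    simpa using le_of_lt hy

lemma lintegral_negPart_stdγ (t : ℝ) :
    ∫⁻ x, ENNReal.ofReal (t - x) ∂stdγ
      = ENNReal.ofReal (2 * gaussianPDFReal 0 2 t + t * stdγ.real (Set.Iic t)) := by
  have h0 : (fun y => ENNReal.ofReal (t - y))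
      = (Set.Iic t).indicator (fun y => ENNReal.ofReal (t - y)) := by
    ext y
    by_cases h : y ≤ t
    · simp [h]
    · simp [h, (not_le.mp h).le]
  have hi : Integrable (fun y => t - y) stdγ := (integrable_const t).sub integrable_id_stdγ
  rw [h0, lintegral_indicator measurableSet_Iic, ← ofReal_integral_eq_lintegral_ofReal hi.integrableOn]
  · rw [integral_sub (integrable_const t) integrable_id_stdγ.integrableOn, setIntegral_Iic_id_stdγ]
    simp [mul_comm, add_comm]
  · filter_upwards [ae_restrict_mem measurableSet_Iic] with y hy
    simpa using hy

/-- The kernel identity behind the one-dimensional Gaussian Poincaré inequality. -/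
lemma stdγ_kernel (t : ℝ) :
    stdγ (Set.Iic t) * ∫⁻ y, ENNReal.ofReal (y - t) ∂stdγ
      + stdγ (Set.Ioi t) * ∫⁻ x, ENNReal.ofReal (t - x) ∂stdγ
      = 2 * gaussianPDF 0 2 t := by
  have hc : stdγ.real (Set.Iic t) + stdγ.real (Set.Ioi t) = 1 := by
    have := probReal_add_probReal_compl (μ := stdγ) (measurableSet_Iic (a := t))
    rwa [Set.compl_Iic] at this
  have h1 : 0 ≤ 2 * gaussianPDFReal 0 2 t - t * stdγ.real (Set.Ioi t) := by
    have : 0 ≤ ∫ x in Set.Ioi t, (x - t) ∂stdγ :=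
      setIntegral_nonneg measurableSet_Ioi fun x hx => sub_nonneg.mpr (le_of_lt hx)
    rw [integral_sub integrable_id_stdγ.integrableOn (integrable_const t),
      setIntegral_Ioi_id_stdγ] at this
    simpa [mul_comm] using this
  have h2 : 0 ≤ 2 * gaussianPDFReal 0 2 t + t * stdγ.real (Set.Iic t) := by
    have : 0 ≤ ∫ x in Set.Iic t, (t - x) ∂stdγ :=
      setIntegral_nonneg measurableSet_Iic fun x hx => sub_nonneg.mpr hx
    rw [integral_sub (integrable_const t) integrable_id_stdγ.integrableOn,
      setIntegral_Iic_id_stdγ] at this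
    simpa [mul_comm, add_comm] using this
  rw [lintegral_posPart_stdγ, lintegral_negPart_stdγ, ← ofReal_measureReal (s := Set.Iic t),
    ← ofReal_measureReal (s := Set.Ioi t), ← ENNReal.ofReal_mul measureReal_nonneg,
    ← ENNReal.ofReal_mul measureReal_nonneg, ← ENNReal.ofReal_add (by positivity) (by positivity),
    gaussianPDF, show (2 : ℝ≥0∞) = ENNReal.ofReal 2 by simp, ← ENNReal.ofReal_mul (by norm_num)]
  congr 1
  linear_combination (2 * gaussianPDFReal 0 2 t) * hc

lemma enorm_sub_sq_le {h h' : ℝ → ℂ} (hd : ∀ x, HasDerivAt h (h' x) x) (hc : Continuous h')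
    {x y : ℝ} (hxy : x ≤ y) :
    ‖h x - h y‖ₑ ^ 2 ≤ ENNReal.ofReal (y - x) * ∫⁻ t in Set.Ioc x y, ‖h' t‖ₑ ^ 2 := by
  have h1 : ‖h x - h y‖ₑ ≤ ∫⁻ t in Set.Ioc x y, ‖h' t‖ₑ := by
    rw [enorm_sub_rev, ← intervalIntegral.integral_eq_sub_of_hasDerivAt (fun t _ => hd t)
      (hc.intervalIntegrable _ _), intervalIntegral.integral_of_le hxy]
    exact enorm_integral_le_lintegral_enorm _
  have h2 := ENNReal.lintegral_mul_le_Lp_mul_Lq (volume.restrict (Set.Ioc x y))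
    Real.HolderConjugate.two_two (f := fun t => ‖h' t‖ₑ) (g := fun _ => 1)
    hc.enorm.measurable.aemeasurable aemeasurable_const
  simp only [Pi.mul_apply, mul_one, ENNReal.rpow_two] at h2
  calc ‖h x - h y‖ₑ ^ 2 ≤ _ := pow_le_pow_left₀ zero_le (h1.trans h2) 2
    _ = _ := by
      rw [mul_pow, ← ENNReal.rpow_two, ← ENNReal.rpow_two, ← ENNReal.rpow_mul, ← ENNReal.rpow_mul]
      norm_num [mul_comm]

lemma measurable_kernel : Measurable (fun p : (ℝ × ℝ) × ℝ =>
    (Set.Iic p.2).indicator (fun _ => ENNReal.ofReal (p.1.2 - p.2)) p.1.1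
      + (Set.Ioi p.2).indicator (fun _ => ENNReal.ofReal (p.2 - p.1.1)) p.1.2) := by
  simp only [Set.indicator_apply, Set.mem_Iic, Set.mem_Ioi]
  refine (Measurable.ite (measurableSet_le (by fun_prop) (by fun_prop)) (by fun_prop)
    measurable_const).add (Measurable.ite (measurableSet_lt (by fun_prop) (by fun_prop))
    (by fun_prop) measurable_const)

/-- One-dimensional Gaussian Poincaré inequality, in doubled-variable form. -/
lemma poincare_one {h h' : ℝ → ℂ} (hd : ∀ x, HasDerivAt h (h' x) x) (hc : Continuous h') :
    ∫⁻ x, ∫⁻ y, ‖h x - h y‖ₑ ^ 2 ∂stdγ ∂stdγ ≤ 4 * ∫⁻ t, ‖h' t‖ₑ ^ 2 ∂stdγ := by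
  have hcont : Continuous h := continuous_iff_continuousAt.mpr fun x => (hd x).continuousAt
  set K : ℝ → ℝ → ℝ → ℝ≥0∞ := fun x y t =>
    (Set.Iic t).indicator (fun _ => ENNReal.ofReal (y - t)) x
      + (Set.Ioi t).indicator (fun _ => ENNReal.ofReal (t - x)) y with hK
  set q : ℝ → ℝ≥0∞ := fun t => ‖h' t‖ₑ ^ 2 with hq
  have hqm : Measurable q := by fun_prop
  set v : ℝ → ℝ → ℝ≥0∞ := fun x y => ∫⁻ t, K x y t * q t with hv
  have hKm : Measurable (fun p : (ℝ × ℝ) × ℝ => K p.1.1 p.1.2 p.2 * q p.2) :=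
    measurable_kernel.mul (hqm.comp measurable_snd)
  have hvm : Measurable (fun p : ℝ × ℝ => v p.1 p.2) := hKm.lintegral_prod_right'
  have key : ∀ x y, x ≤ y → ‖h x - h y‖ₑ ^ 2 ≤ v x y := by
    intro x y hxy
    refine (enorm_sub_sq_le hd hc hxy).trans ?_
    rw [← restrict_Ico_eq_restrict_Ioc, ← lintegral_const_mul _ hqm,
      ← lintegral_indicator measurableSet_Ico]
    refine lintegral_mono fun t => ?_
    by_cases ht : t ∈ Set.Ico x y
    · simp only [ht, Set.indicator_of_mem, hK]
      gcongr
      rw [Set.indicator_of_mem (by exact ht.1), Set.indicator_of_mem (by exact ht.2)]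
      rw [show y - x = (y - t) + (t - x) by ring]
      exact ENNReal.ofReal_add_le
    · simp [ht]
  have key2 : ∀ x y, ‖h x - h y‖ₑ ^ 2 ≤ v x y + v y x := by
    intro x y
    rcases le_total x y with hxy | hxy
    · exact (key x y hxy).trans le_self_add
    · rw [enorm_sub_rev]; exact (key y x hxy).trans le_add_self
  have hsum : ∫⁻ x, ∫⁻ y, v x y ∂stdγ ∂stdγ = 2 * ∫⁻ t, q t ∂stdγ := by
    have e1 : ∀ x, ∫⁻ y, v x y ∂stdγ = ∫⁻ t, (∫⁻ y, K x y t ∂stdγ) * q t := by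
      intro x
      have hm : Measurable (fun p : ℝ × ℝ => K x p.1 p.2 * q p.2) :=
        hKm.comp (f := fun p : ℝ × ℝ => ((x, p.1), p.2)) (by fun_prop)
      rw [lintegral_lintegral_swap hm.aemeasurable]
      refine lintegral_congr fun t => ?_
      rw [lintegral_mul_const]
      exact measurable_kernel.comp (f := fun y : ℝ => ((x, y), t)) (by fun_prop)
    have hKy : Measurable (fun p : ℝ × ℝ => ∫⁻ y, K p.1 y p.2 ∂stdγ) :=
      Measurable.lintegral_prod_right' (f := fun p : (ℝ × ℝ) × ℝ => K p.1.1 p.2 p.1.2)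
        (measurable_kernel.comp (f := fun p : (ℝ × ℝ) × ℝ => ((p.1.1, p.2), p.1.2)) (by fun_prop))
    simp_rw [e1]
    rw [lintegral_lintegral_swap (f := fun x t => (∫⁻ y, K x y t ∂stdγ) * q t)
      (hKy.mul (hqm.comp measurable_snd)).aemeasurable]
    have e2 : ∀ t, ∫⁻ x, (∫⁻ y, K x y t ∂stdγ) * q t ∂stdγ = 2 * gaussianPDF 0 2 t * q t := by
      intro t
      have hm : Measurable (fun x => ∫⁻ y, K x y t ∂stdγ) :=
        hKy.comp (f := fun x : ℝ => (x, t)) (by fun_prop)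
      rw [lintegral_mul_const _ hm, ← stdγ_kernel t]
      congr 1
      have e3 : ∀ x, ∫⁻ y, K x y t ∂stdγ
          = (Set.Iic t).indicator (fun _ => ∫⁻ y, ENNReal.ofReal (y - t) ∂stdγ) x
            + ENNReal.ofReal (t - x) * stdγ (Set.Ioi t) := by
        intro x
        simp only [hK]
        rw [lintegral_add_right _ ((measurable_const.indicator measurableSet_Ioi)),
          lintegral_indicator_const measurableSet_Ioi]
        by_cases hx : x ∈ Set.Iic t <;> simp [hx]
      simp_rw [e3]
      rw [lintegral_add_left (measurable_const.indicator measurableSet_Iic),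
        lintegral_indicator_const measurableSet_Iic, lintegral_mul_const _ (by fun_prop)]
      ring
    simp_rw [e2]
    rw [stdγ, gaussianReal_of_var_ne_zero _ (by norm_num),
      lintegral_withDensity_eq_lintegral_mul _ (measurable_gaussianPDF _ _) hqm,
      ← lintegral_const_mul _ ((measurable_gaussianPDF _ _).mul hqm)]
    refine lintegral_congr fun t => ?_
    simp only [Pi.mul_apply]; ring
  calc ∫⁻ x, ∫⁻ y, ‖h x - h y‖ₑ ^ 2 ∂stdγ ∂stdγ
      ≤ ∫⁻ x, ∫⁻ y, (v x y + v y x) ∂stdγ ∂stdγ :=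
        lintegral_mono fun x => lintegral_mono fun y => key2 x y
    _ = ∫⁻ x, ∫⁻ y, v x y ∂stdγ ∂stdγ + ∫⁻ x, ∫⁻ y, v y x ∂stdγ ∂stdγ := by
        rw [← lintegral_add_left hvm.lintegral_prod_right']
        refine lintegral_congr fun x => ?_
        have hm : Measurable (fun y => v x y) :=
          hvm.comp (f := fun y : ℝ => (x, y)) (by fun_prop)
        rw [lintegral_add_left hm]
    _ = 4 * ∫⁻ t, q t ∂stdγ := by
        rw [lintegral_lintegral_swap (f := fun x y => v y x)
          (hvm.comp measurable_swap).aemeasurable, hsum]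
        ring

lemma parallelogram_enorm (a b c d : ℂ) :
    ‖a - d‖ₑ ^ 2 + ‖b - c‖ₑ ^ 2
      ≤ (‖a - b‖ₑ ^ 2 + ‖c - d‖ₑ ^ 2) + (‖a - c‖ₑ ^ 2 + ‖b - d‖ₑ ^ 2) := by
  have e : ∀ z : ℂ, ‖z‖ₑ ^ 2 = ENNReal.ofReal (z.re ^ 2 + z.im ^ 2) := fun z => by
    rw [← ofReal_norm, ← ENNReal.ofReal_pow (norm_nonneg _), Complex.sq_norm,
      Complex.normSq_apply]
    ring_nf
  simp only [e]
  rw [← ENNReal.ofReal_add (by positivity) (by positivity),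
    ← ENNReal.ofReal_add (by positivity) (by positivity),
    ← ENNReal.ofReal_add (by positivity) (by positivity),
    ← ENNReal.ofReal_add (by positivity) (by positivity)]
  apply ENNReal.ofReal_le_ofReal
  simp only [Complex.sub_re, Complex.sub_im]
  nlinarith [sq_nonneg (a.re - b.re - c.re + d.re), sq_nonneg (a.im - b.im - c.im + d.im)]

/-- Efron–Stein type tensorization of the doubled variance. -/
lemma tensorization {H : ℝ × ℝ → ℂ} (hH : Continuous H) :
    ∫⁻ x₁, ∫⁻ y₁, ∫⁻ x₂, ∫⁻ y₂, ‖H (x₁, x₂) - H (y₁, y₂)‖ₑ ^ 2 ∂stdγ ∂stdγ ∂stdγ ∂stdγ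
      ≤ ∫⁻ x₁, ∫⁻ y₁, ∫⁻ x₂, ‖H (x₁, x₂) - H (y₁, x₂)‖ₑ ^ 2 ∂stdγ ∂stdγ ∂stdγ
        + ∫⁻ x₁, ∫⁻ x₂, ∫⁻ y₂, ‖H (x₁, x₂) - H (x₁, y₂)‖ₑ ^ 2 ∂stdγ ∂stdγ ∂stdγ := by
  set D := ∫⁻ x₁, ∫⁻ y₁, ∫⁻ x₂, ∫⁻ y₂, ‖H (x₁, x₂) - H (y₁, y₂)‖ₑ ^ 2 ∂stdγ ∂stdγ ∂stdγ ∂stdγ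
  set A := ∫⁻ x₁, ∫⁻ y₁, ∫⁻ x₂, ‖H (x₁, x₂) - H (y₁, x₂)‖ₑ ^ 2 ∂stdγ ∂stdγ ∂stdγ
  set B := ∫⁻ x₁, ∫⁻ x₂, ∫⁻ y₂, ‖H (x₁, x₂) - H (x₁, y₂)‖ₑ ^ 2 ∂stdγ ∂stdγ ∂stdγ
  set μ := (stdγ.prod stdγ).prod (stdγ.prod stdγ) with hμ
  have iter : ∀ F : ℝ → ℝ → ℝ → ℝ → ℝ≥0∞,
      Measurable (fun p : (ℝ × ℝ) × (ℝ × ℝ) => F p.1.1 p.1.2 p.2.1 p.2.2) →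
      ∫⁻ p, F p.1.1 p.1.2 p.2.1 p.2.2 ∂μ
        = ∫⁻ x₁, ∫⁻ y₁, ∫⁻ x₂, ∫⁻ y₂, F x₁ y₁ x₂ y₂ ∂stdγ ∂stdγ ∂stdγ ∂stdγ := by
    intro F hF
    rw [hμ, lintegral_prod _ hF.aemeasurable, lintegral_prod _ (hF.lintegral_prod_right').aemeasurable]
    refine lintegral_congr fun x₁ => lintegral_congr fun y₁ => ?_
    rw [lintegral_prod]
    exact (hF.comp (f := fun q : ℝ × ℝ => ((x₁, y₁), q)) (by fun_prop)).aemeasurable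
  have m1 : Measurable fun p : (ℝ × ℝ) × (ℝ × ℝ) =>
      ‖H (p.1.1, p.2.1) - H (p.1.2, p.2.2)‖ₑ ^ 2 := by fun_prop
  have m2 : Measurable fun p : (ℝ × ℝ) × (ℝ × ℝ) =>
      ‖H (p.1.2, p.2.1) - H (p.1.1, p.2.2)‖ₑ ^ 2 := by fun_prop
  have m3 : Measurable fun p : (ℝ × ℝ) × (ℝ × ℝ) =>
      ‖H (p.1.1, p.2.1) - H (p.1.2, p.2.1)‖ₑ ^ 2 := by fun_prop
  have m4 : Measurable fun p : (ℝ × ℝ) × (ℝ × ℝ) =>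
      ‖H (p.1.1, p.2.2) - H (p.1.2, p.2.2)‖ₑ ^ 2 := by fun_prop
  have m5 : Measurable fun p : (ℝ × ℝ) × (ℝ × ℝ) =>
      ‖H (p.1.1, p.2.1) - H (p.1.1, p.2.2)‖ₑ ^ 2 := by fun_prop
  have m6 : Measurable fun p : (ℝ × ℝ) × (ℝ × ℝ) =>
      ‖H (p.1.2, p.2.1) - H (p.1.2, p.2.2)‖ₑ ^ 2 := by fun_prop
  have m34 : Measurable fun p : (ℝ × ℝ) × (ℝ × ℝ) =>
      ‖H (p.1.1, p.2.1) - H (p.1.2, p.2.1)‖ₑ ^ 2 + ‖H (p.1.1, p.2.2) - H (p.1.2, p.2.2)‖ₑ ^ 2 :=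
    m3.add m4
  have h := lintegral_mono (μ := μ) fun p : (ℝ × ℝ) × (ℝ × ℝ) =>
    parallelogram_enorm (H (p.1.1, p.2.1)) (H (p.1.2, p.2.1)) (H (p.1.1, p.2.2)) (H (p.1.2, p.2.2))
  rw [lintegral_add_left m1, lintegral_add_left m34, lintegral_add_left m3,
    lintegral_add_left m5] at h
  rw [iter (fun x₁ y₁ x₂ y₂ => ‖H (x₁, x₂) - H (y₁, y₂)‖ₑ ^ 2) m1,
    iter (fun x₁ y₁ x₂ y₂ => ‖H (y₁, x₂) - H (x₁, y₂)‖ₑ ^ 2) m2,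
    iter (fun x₁ y₁ x₂ y₂ => ‖H (x₁, x₂) - H (y₁, x₂)‖ₑ ^ 2) m3,
    iter (fun x₁ y₁ x₂ y₂ => ‖H (x₁, y₂) - H (y₁, y₂)‖ₑ ^ 2) m4,
    iter (fun x₁ y₁ x₂ y₂ => ‖H (x₁, x₂) - H (x₁, y₂)‖ₑ ^ 2) m5,
    iter (fun x₁ y₁ x₂ y₂ => ‖H (y₁, x₂) - H (y₁, y₂)‖ₑ ^ 2) m6] at h
  simp only [lintegral_const, measure_univ, mul_one] at h
  have sw : ∫⁻ x₁, ∫⁻ y₁, ∫⁻ x₂, ∫⁻ y₂, ‖H (y₁, x₂) - H (x₁, y₂)‖ₑ ^ 2 ∂stdγ ∂stdγ ∂stdγ ∂stdγ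
      = D := by
    rw [lintegral_lintegral_swap]
    have : Measurable fun p : ℝ × ℝ => ∫⁻ q : ℝ × ℝ,
        ‖H (p.2, q.1) - H (p.1, q.2)‖ₑ ^ 2 ∂(stdγ.prod stdγ) :=
      Measurable.lintegral_prod_right' (f := fun z : (ℝ × ℝ) × (ℝ × ℝ) =>
        ‖H (z.1.2, z.2.1) - H (z.1.1, z.2.2)‖ₑ ^ 2) m2
    convert this.aemeasurable using 1
    ext p
    rw [lintegral_prod _ (by fun_prop)]
    rfl
  rw [sw] at h
  have h' : 2 * D ≤ 2 * (A + B) := by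
    calc 2 * D = D + D := two_mul _
      _ ≤ A + A + (B + B) := h
      _ = 2 * (A + B) := by ring
  exact (ENNReal.mul_le_mul_iff_right (by norm_num) (by norm_num)).mp h'

lemma lintegral_norm_sub_sq {H : ℝ × ℝ → ℂ} (hi : Integrable H (stdγ.prod stdγ))
    (h2 : Integrable (fun p => ‖H p‖ ^ 2) (stdγ.prod stdγ))
    (h0 : ∫ p, H p ∂(stdγ.prod stdγ) = 0) :
    ∫⁻ q, ∫⁻ p, ‖H p - H q‖ₑ ^ 2 ∂(stdγ.prod stdγ) ∂(stdγ.prod stdγ)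
      = 2 * ENNReal.ofReal (∫ p, ‖H p‖ ^ 2 ∂(stdγ.prod stdγ)) := by
  set μ := stdγ.prod stdγ
  set V := ∫ p, ‖H p‖ ^ 2 ∂μ with hV
  have hV0 : 0 ≤ V := integral_nonneg fun _ => by positivity
  have e1 : ∀ q, ∫⁻ p, ‖H p - H q‖ₑ ^ 2 ∂μ = ENNReal.ofReal (V + ‖H q‖ ^ 2) := by
    intro q
    have hx : ∀ p, ‖H p - H q‖ ^ 2
        = ‖H p‖ ^ 2 + ‖H q‖ ^ 2 - 2 * (H p * (starRingEnd ℂ) (H q)).re := by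
      intro p
      simp only [Complex.sq_norm, Complex.normSq_apply, Complex.sub_re, Complex.sub_im,
        Complex.mul_re, Complex.conj_re, Complex.conj_im]
      ring
    have hre : Integrable (fun p => (H p * (starRingEnd ℂ) (H q)).re) μ :=
      (hi.mul_const _).re
    have hre0 : ∫ p, (H p * (starRingEnd ℂ) (H q)).re ∂μ = 0 := by
      have := integral_re (hi.mul_const ((starRingEnd ℂ) (H q)))
      rw [integral_mul_const, h0] at this
      simpa using this
    have hint : Integrable (fun p => ‖H p - H q‖ ^ 2) μ := by
      simp only [hx]
      exact (h2.add (integrable_const _)).sub (hre.const_mul 2)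
    have hsum : Integrable (fun p => ‖H p‖ ^ 2 + ‖H q‖ ^ 2) μ := h2.add (integrable_const _)
    have : ∫ p, ‖H p - H q‖ ^ 2 ∂μ = V + ‖H q‖ ^ 2 := by
      simp only [hx]
      rw [integral_sub hsum (hre.const_mul 2),
        integral_add h2 (integrable_const _), integral_const_mul, hre0]
      simp [hV]
    rw [← this, ofReal_integral_eq_lintegral_ofReal hint (ae_of_all _ fun _ => by positivity)]
    refine lintegral_congr fun p => ?_
    rw [← ofReal_norm, ENNReal.ofReal_pow (norm_nonneg _)]
  have hsum : Integrable (fun q => V + ‖H q‖ ^ 2) μ := (integrable_const _).add h2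
  simp_rw [e1]
  rw [← ofReal_integral_eq_lintegral_ofReal hsum
    (ae_of_all _ fun _ => by positivity), integral_add (integrable_const _) h2,
    show (2 : ℝ≥0∞) = ENNReal.ofReal 2 by simp, ← ENNReal.ofReal_mul (by norm_num)]
  congr 1
  simp [← hV]; ring

/-- Gaussian Poincaré inequality on `ℝ × ℝ`. -/
lemma poincare_two {H H₁ H₂ : ℝ × ℝ → ℂ} (hH : Continuous H) (hH₁ : Continuous H₁)
    (hH₂ : Continuous H₂)
    (hd₁ : ∀ x y, HasDerivAt (fun s => H (s, y)) (H₁ (x, y)) x)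
    (hd₂ : ∀ x y, HasDerivAt (fun s => H (x, s)) (H₂ (x, y)) y)
    (hi : Integrable H (stdγ.prod stdγ))
    (h2 : Integrable (fun p => ‖H p‖ ^ 2) (stdγ.prod stdγ))
    (h0 : ∫ p, H p ∂(stdγ.prod stdγ) = 0) :
    ENNReal.ofReal (∫ p, ‖H p‖ ^ 2 ∂(stdγ.prod stdγ))
      ≤ 2 * ∫⁻ p, (‖H₁ p‖ₑ ^ 2 + ‖H₂ p‖ₑ ^ 2) ∂(stdγ.prod stdγ) := by
  have hA : ∫⁻ x₁, ∫⁻ y₁, ∫⁻ x₂, ‖H (x₁, x₂) - H (y₁, x₂)‖ₑ ^ 2 ∂stdγ ∂stdγ ∂stdγ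
      ≤ 4 * ∫⁻ p, ‖H₁ p‖ₑ ^ 2 ∂(stdγ.prod stdγ) := by
    have e : ∫⁻ x₁, ∫⁻ y₁, ∫⁻ x₂, ‖H (x₁, x₂) - H (y₁, x₂)‖ₑ ^ 2 ∂stdγ ∂stdγ ∂stdγ
        = ∫⁻ x₂, ∫⁻ x₁, ∫⁻ y₁, ‖H (x₁, x₂) - H (y₁, x₂)‖ₑ ^ 2 ∂stdγ ∂stdγ ∂stdγ := by
      rw [lintegral_lintegral_swap (f := fun x₂ x₁ => ∫⁻ y₁, ‖H (x₁, x₂) - H (y₁, x₂)‖ₑ ^ 2 ∂stdγ)]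
      · refine lintegral_congr fun x₁ => ?_
        rw [lintegral_lintegral_swap]
        exact Measurable.aemeasurable (by fun_prop)
      · exact (Measurable.lintegral_prod_right' (f := fun z : (ℝ × ℝ) × ℝ =>
          ‖H (z.1.2, z.1.1) - H (z.2, z.1.1)‖ₑ ^ 2) (by fun_prop)).aemeasurable
    rw [e, lintegral_prod_symm _ (by fun_prop), ← lintegral_const_mul _
      (Measurable.lintegral_prod_left' (f := fun p => ‖H₁ p‖ₑ ^ 2) (by fun_prop))]
    exact lintegral_mono fun x₂ => poincare_one (fun x => hd₁ x x₂) (by fun_prop)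
  have hB : ∫⁻ x₁, ∫⁻ x₂, ∫⁻ y₂, ‖H (x₁, x₂) - H (x₁, y₂)‖ₑ ^ 2 ∂stdγ ∂stdγ ∂stdγ
      ≤ 4 * ∫⁻ p, ‖H₂ p‖ₑ ^ 2 ∂(stdγ.prod stdγ) := by
    rw [lintegral_prod _ (by fun_prop), ← lintegral_const_mul _
      (Measurable.lintegral_prod_right' (f := fun p => ‖H₂ p‖ₑ ^ 2) (by fun_prop))]
    exact lintegral_mono fun x₁ => poincare_one (fun x => hd₂ x₁ x) (by fun_prop)
  have hD : ∫⁻ q, ∫⁻ p, ‖H p - H q‖ₑ ^ 2 ∂(stdγ.prod stdγ) ∂(stdγ.prod stdγ)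
      = ∫⁻ x₁, ∫⁻ y₁, ∫⁻ x₂, ∫⁻ y₂, ‖H (x₁, x₂) - H (y₁, y₂)‖ₑ ^ 2
        ∂stdγ ∂stdγ ∂stdγ ∂stdγ := by
    have m : Measurable fun z : (ℝ × ℝ) × (ℝ × ℝ) => ‖H z.2 - H z.1‖ₑ ^ 2 := by fun_prop
    rw [lintegral_prod _ m.lintegral_prod_right'.aemeasurable]
    refine lintegral_congr fun x₁ => ?_
    rw [lintegral_lintegral_swap (f := fun y₁ x₂ => ∫⁻ y₂, ‖H (x₁, x₂) - H (y₁, y₂)‖ₑ ^ 2 ∂stdγ)]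
    · refine lintegral_congr fun x₂ => ?_
      rw [lintegral_prod _ (by fun_prop)]
      simp_rw [enorm_sub_rev]
    · exact (Measurable.lintegral_prod_right' (f := fun z : (ℝ × ℝ) × ℝ =>
          ‖H (x₁, z.1.2) - H (z.1.1, z.2)‖ₑ ^ 2) (by fun_prop)).aemeasurable
  have h := (tensorization hH).trans (add_le_add hA hB)
  rw [← hD, lintegral_norm_sub_sq hi h2 h0] at h
  rw [lintegral_add_left (by fun_prop)]
  refine (ENNReal.mul_le_mul_iff_right (a := 2) (by norm_num) (by norm_num)).mp (h.trans_eq ?_)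
  ring

@[simp] lemma v2_zero (a b : ℝ) : v2 a b 0 = a := rfl
@[simp] lemma v2_one (a b : ℝ) : v2 a b 1 = b := rfl

lemma norm_sq_R2 (ξ : R2) : ‖ξ‖ ^ 2 = ξ 0 ^ 2 + ξ 1 ^ 2 := by
  simp [EuclideanSpace.norm_sq_eq]

lemma v2_eq (a b : ℝ) : v2 a b = a • e2 0 + b • e2 1 := by
  ext i; fin_cases i <;> simp [v2, e2]

lemma eq_sum_e2 (ξ : R2) : ξ = ξ 0 • e2 0 + ξ 1 • e2 1 := by
  ext i; fin_cases i <;> simp [e2]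

lemma continuous_v2 : Continuous fun p : ℝ × ℝ => v2 p.1 p.2 := by
  simp only [v2_eq]; fun_prop

lemma measurePreserving_v2_volume :
    MeasurePreserving (fun p : ℝ × ℝ => v2 p.1 p.2) volume volume :=
  (PiLp.volume_preserving_toLp (Fin 2)).comp (volume_preserving_finTwoArrow ℝ).symm

lemma continuous_Gval : Continuous Gval := by unfold Gval; fun_prop

lemma Gval_pos (ξ : R2) : 0 < Gval ξ := by unfold Gval; positivity

lemma pdf_mul_pdf (x y : ℝ) :
    gaussianPDF 0 2 x * gaussianPDF 0 2 y = ENNReal.ofReal (Gval (v2 x y)) := by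
  rw [gaussianPDF, gaussianPDF, ← ENNReal.ofReal_mul (gaussianPDFReal_nonneg _ _ _)]
  congr 1
  simp only [gaussianPDFReal, Gval, norm_sq_R2, v2_zero, v2_one]
  rw [mul_mul_mul_comm, ← Real.exp_add, ← mul_inv, Real.mul_self_sqrt (by positivity)]
  congr 2
  · simp; ring
  · simp; ring

lemma measurePreserving_v2 :
    MeasurePreserving (fun p : ℝ × ℝ => v2 p.1 p.2) (stdγ.prod stdγ)
      (volume.withDensity fun ξ => ENNReal.ofReal (Gval ξ)) := by
  refine ⟨continuous_v2.measurable, ?_⟩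
  ext s hs
  rw [Measure.map_apply continuous_v2.measurable hs, stdγ,
    gaussianReal_of_var_ne_zero _ (by norm_num),
    prod_withDensity (measurable_gaussianPDF _ _) (measurable_gaussianPDF _ _),
    withDensity_apply _ (continuous_v2.measurable hs), withDensity_apply _ hs]
  simp only [pdf_mul_pdf]
  exact measurePreserving_v2_volume.setLIntegral_comp_preimage hs
    (f := fun ξ => ENNReal.ofReal (Gval ξ)) continuous_Gval.measurable.ennreal_ofReal

lemma integrable_gauss_iff {E : Type*} [NormedAddCommGroup E] [NormedSpace ℝ E] {u : R2 → E} (hu : Continuous u) :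
    Integrable (fun p : ℝ × ℝ => u (v2 p.1 p.2)) (stdγ.prod stdγ)
      ↔ Integrable (fun ξ => Gval ξ • u ξ) := by
  rw [show (fun p : ℝ × ℝ => u (v2 p.1 p.2)) = u ∘ (fun p : ℝ × ℝ => v2 p.1 p.2) from rfl,
    measurePreserving_v2.integrable_comp hu.aestronglyMeasurable,
    integrable_withDensity_iff_integrable_smul' continuous_Gval.measurable.ennreal_ofReal
      (by simp)]
  simp [ENNReal.toReal_ofReal (Gval_pos _).le]

lemma integral_gauss {E : Type*} [NormedAddCommGroup E] [NormedSpace ℝ E] {u : R2 → E}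
    (hu : Continuous u) :
    ∫ p : ℝ × ℝ, u (v2 p.1 p.2) ∂(stdγ.prod stdγ) = ∫ ξ, Gval ξ • u ξ := by
  rw [← integral_map (μ := stdγ.prod stdγ) (f := u) measurePreserving_v2.aemeasurable
    (hu.aestronglyMeasurable), measurePreserving_v2.map_eq,
    integral_withDensity_eq_integral_toReal_smul continuous_Gval.measurable.ennreal_ofReal
      (by simp)]
  simp [ENNReal.toReal_ofReal (Gval_pos _).le]

lemma lintegral_gauss {u : R2 → ℝ} (hu : Continuous u) (h0 : ∀ ξ, 0 ≤ u ξ)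
    (hi : Integrable (fun ξ => Gval ξ * u ξ)) :
    ∫⁻ p : ℝ × ℝ, ENNReal.ofReal (u (v2 p.1 p.2)) ∂(stdγ.prod stdγ)
      = ENNReal.ofReal (∫ ξ, Gval ξ * u ξ) := by
  rw [measurePreserving_v2.lintegral_comp (f := fun ξ => ENNReal.ofReal (u ξ)) (by fun_prop),
    lintegral_withDensity_eq_lintegral_mul _ continuous_Gval.measurable.ennreal_ofReal (by fun_prop),
    ofReal_integral_eq_lintegral_ofReal hi
      (ae_of_all _ fun ξ => mul_nonneg (Gval_pos ξ).le (h0 ξ))]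
  simp [ENNReal.ofReal_mul (Gval_pos _).le]

/-- Gaussian Poincaré inequality on the plane, with respect to the measure `G dξ`. -/
lemma poincare_R2 {h : R2 → ℂ} (hC : ContDiff ℝ 1 h)
    (hi : Integrable fun ξ => Gval ξ • h ξ) (h2 : Integrable fun ξ => Gval ξ * ‖h ξ‖ ^ 2)
    (h0 : ∫ ξ, Gval ξ • h ξ = 0)
    (hd : ∀ i, Integrable fun ξ => Gval ξ * ‖fderiv ℝ h ξ (e2 i)‖ ^ 2) :
    ∫ ξ, Gval ξ * ‖h ξ‖ ^ 2 ≤ 2 * ((∫ ξ, Gval ξ * ‖fderiv ℝ h ξ (e2 0)‖ ^ 2)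
      + ∫ ξ, Gval ξ * ‖fderiv ℝ h ξ (e2 1)‖ ^ 2) := by
  have hc := hC.continuous
  have hcd : ∀ i, Continuous fun ξ => fderiv ℝ h ξ (e2 i) := fun i =>
    (hC.continuous_fderiv (by norm_num)).clm_apply continuous_const
  have hdiff : ∀ ξ, HasFDerivAt h (fderiv ℝ h ξ) ξ := fun ξ =>
    (hC.differentiable (by norm_num) ξ).hasFDerivAt
  have e1 : ∀ x y, HasDerivAt (fun s => v2 s y) (e2 0) x := fun x y => by
    simp only [v2_eq]
    simpa using ((hasDerivAt_id x).smul_const (e2 0)).add_const (y • e2 1)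
  have e3 : ∀ x y, HasDerivAt (fun s => v2 x s) (e2 1) y := fun x y => by
    simp only [v2_eq]
    simpa using ((hasDerivAt_id y).smul_const (e2 1)).const_add (x • e2 0)
  have hI : Integrable (fun p : ℝ × ℝ => ‖h (v2 p.1 p.2)‖ ^ 2) (stdγ.prod stdγ) :=
    (integrable_gauss_iff (u := fun ξ => ‖h ξ‖ ^ 2) (by fun_prop)).mpr (by simpa using h2)
  have key := poincare_two (H := fun p => h (v2 p.1 p.2))
    (H₁ := fun p => fderiv ℝ h (v2 p.1 p.2) (e2 0))
    (H₂ := fun p => fderiv ℝ h (v2 p.1 p.2) (e2 1)) (hc.comp continuous_v2)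
    ((hcd 0).comp continuous_v2) ((hcd 1).comp continuous_v2)
    (fun x y => (hdiff _).comp_hasDerivAt x (e1 x y))
    (fun x y => (hdiff _).comp_hasDerivAt y (e3 x y))
    ((integrable_gauss_iff hc).mpr hi) hI (by rw [integral_gauss hc, h0])
  have en : ∀ z : ℂ, ‖z‖ₑ ^ 2 = ENNReal.ofReal (‖z‖ ^ 2) := fun z => by
    rw [← ofReal_norm, ENNReal.ofReal_pow (norm_nonneg _)]
  simp only [en] at key
  rw [integral_gauss (u := fun ξ => ‖h ξ‖ ^ 2) (by fun_prop), lintegral_add_left,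
    lintegral_gauss (u := fun ξ => ‖fderiv ℝ h ξ (e2 0)‖ ^ 2) ((hcd 0).norm.pow 2)
      (fun _ => by positivity) (hd 0),
    lintegral_gauss (u := fun ξ => ‖fderiv ℝ h ξ (e2 1)‖ ^ 2) ((hcd 1).norm.pow 2)
      (fun _ => by positivity) (hd 1)] at key
  · have p0 : ∀ i, 0 ≤ ∫ ξ, Gval ξ * ‖fderiv ℝ h ξ (e2 i)‖ ^ 2 := fun i =>
      integral_nonneg fun ξ => mul_nonneg (Gval_pos ξ).le (by positivity)
    have two : (2 : ℝ≥0∞) = ENNReal.ofReal 2 := by simp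
    rw [← ENNReal.ofReal_add (p0 0) (p0 1)] at key
    replace key := key.trans_eq (congrArg (· * _) two)
    rw [← ENNReal.ofReal_mul (by norm_num), ENNReal.ofReal_le_ofReal_iff
      (mul_nonneg (by norm_num) (add_nonneg (p0 0) (p0 1)))] at key
    simpa using key
  · exact (((hcd 0).comp continuous_v2).norm.pow 2).measurable.ennreal_ofReal

end Poincare

/-- The inverse Gaussian weight. -/
def wt (ξ : R2) : ℝ := Real.exp (‖ξ‖ ^ 2 / 4)

lemma wt_pos (ξ : R2) : 0 < wt ξ := Real.exp_pos _

lemma one_le_wt (ξ : R2) : 1 ≤ wt ξ := Real.one_le_exp (by positivity)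

lemma contDiff_wt : ContDiff ℝ 1 wt :=
  Real.contDiff_exp.comp ((contDiff_norm_sq ℝ).div_const _)

lemma continuous_wt : Continuous wt := contDiff_wt.continuous

lemma Gval_mul_wt (ξ : R2) : Gval ξ * wt ξ = (4 * π)⁻¹ := by
  rw [Gval, wt, mul_assoc, ← Real.exp_add]
  simp [neg_div]

lemma norm_coord_le (ξ : R2) (i : Fin 2) : ‖ξ i‖ ≤ ‖ξ‖ := PiLp.norm_apply_le ξ i

/-- Functions all of whose polynomial multiples are square integrable for the weight `wt`. -/
def GaussL2 (u : R2 → ℂ) : Prop :=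
  AEStronglyMeasurable u volume ∧
    ∀ k : ℕ, Integrable fun ξ => ‖ξ‖ ^ (2 * k) * ‖u ξ‖ ^ 2 * wt ξ

namespace GaussL2

lemma of_le {u v : R2 → ℂ} (hu : GaussL2 u) (hv : AEStronglyMeasurable v volume) (C : ℝ) (m : ℕ)
    (h : ∀ ξ, ‖v ξ‖ ≤ C * ‖ξ‖ ^ m * ‖u ξ‖) : GaussL2 v := by
  refine ⟨hv, fun k => ?_⟩
  refine ((hu.2 (k + m)).const_mul (C ^ 2)).mono' ?_ (ae_of_all _ fun ξ => ?_)
  · exact (((continuous_norm.pow _).aestronglyMeasurable).mul (hv.norm.pow 2)).mul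
      continuous_wt.aestronglyMeasurable
  · have h1 : ‖v ξ‖ ^ 2 ≤ (C * ‖ξ‖ ^ m * ‖u ξ‖) ^ 2 := pow_le_pow_left₀ (norm_nonneg _) (h ξ) 2
    have hw := (wt_pos ξ).le
    rw [Real.norm_of_nonneg (by positivity)]
    calc ‖ξ‖ ^ (2 * k) * ‖v ξ‖ ^ 2 * wt ξ
        ≤ ‖ξ‖ ^ (2 * k) * (C * ‖ξ‖ ^ m * ‖u ξ‖) ^ 2 * wt ξ := by gcongr
      _ = _ := by ring

lemma add {u v : R2 → ℂ} (hu : GaussL2 u) (hv : GaussL2 v) : GaussL2 fun ξ => u ξ + v ξ := by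
  refine ⟨hu.1.add hv.1, fun k => ?_⟩
  refine (((hu.2 k).const_mul 2).add ((hv.2 k).const_mul 2)).mono' ?_ (ae_of_all _ fun ξ => ?_)
  · exact (((continuous_norm.pow _).aestronglyMeasurable).mul ((hu.1.add hv.1).norm.pow 2)).mul
      continuous_wt.aestronglyMeasurable
  · have hw := (wt_pos ξ).le
    have h1 : ‖u ξ + v ξ‖ ^ 2 ≤ 2 * ‖u ξ‖ ^ 2 + 2 * ‖v ξ‖ ^ 2 := by
      have := pow_le_pow_left₀ (norm_nonneg _) (norm_add_le (u ξ) (v ξ)) 2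
      nlinarith [sq_nonneg (‖u ξ‖ - ‖v ξ‖)]
    rw [Real.norm_of_nonneg (by positivity)]
    calc ‖ξ‖ ^ (2 * k) * ‖u ξ + v ξ‖ ^ 2 * wt ξ
        ≤ ‖ξ‖ ^ (2 * k) * (2 * ‖u ξ‖ ^ 2 + 2 * ‖v ξ‖ ^ 2) * wt ξ := by gcongr
      _ = _ := by simp only [Pi.add_apply]; ring

lemma const_mul {u : R2 → ℂ} (hu : GaussL2 u) (c : ℂ) : GaussL2 fun ξ => c * u ξ :=
  hu.of_le (hu.1.const_mul c) ‖c‖ 0 fun ξ => by simp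

lemma coord_mul {u : R2 → ℂ} (hu : GaussL2 u) (i : Fin 2) : GaussL2 fun ξ => (ξ i : ℂ) * u ξ :=
  hu.of_le ((Continuous.aestronglyMeasurable (by fun_prop)).mul hu.1) 1 1 fun ξ => by
    rw [norm_mul, Complex.norm_real, one_mul, pow_one]
    gcongr
    exact norm_coord_le ξ i

lemma conj {u : R2 → ℂ} (hu : GaussL2 u) : GaussL2 fun ξ => starRingEnd ℂ (u ξ) :=
  hu.of_le (Complex.continuous_conj.comp_aestronglyMeasurable hu.1) 1 0 fun ξ => by simp

lemma integrable_sq {u : R2 → ℂ} (hu : GaussL2 u) : Integrable fun ξ => ‖u ξ‖ ^ 2 * wt ξ := by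
  simpa using hu.2 0

lemma integrable_norm_sq {u : R2 → ℂ} (hu : GaussL2 u) : Integrable fun ξ => ‖u ξ‖ ^ 2 :=
  hu.integrable_sq.mono' (hu.1.norm.pow 2) (ae_of_all _ fun ξ => by
    rw [Real.norm_of_nonneg (by positivity)]
    exact le_mul_of_one_le_right (by positivity) (one_le_wt ξ))

lemma integrable_mul {u v : R2 → ℂ} (hu : GaussL2 u) (hv : GaussL2 v) :
    Integrable fun ξ => u ξ * (v ξ * wt ξ) := by
  refine (hu.integrable_sq.add hv.integrable_sq).mono' ?_ (ae_of_all _ fun ξ => ?_)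
  · exact hu.1.mul (hv.1.mul (Complex.continuous_ofReal.comp continuous_wt).aestronglyMeasurable)
  · have hw := wt_pos ξ
    simp only [norm_mul, Complex.norm_real, Real.norm_of_nonneg hw.le, Pi.add_apply]
    nlinarith [sq_nonneg (‖u ξ‖ - ‖v ξ‖), mul_nonneg hw.le (sq_nonneg (‖u ξ‖ - ‖v ξ‖)),
      mul_nonneg hw.le (sq_nonneg ‖u ξ‖), mul_nonneg hw.le (sq_nonneg ‖v ξ‖)]

lemma integrable {u : R2 → ℂ} (hu : GaussL2 u) : Integrable u := by
  have hG : Integrable fun ξ : R2 => (wt ξ)⁻¹ := by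
    have := (GaussianFourier.integrable_cexp_neg_mul_sq_norm_add (V := R2) (b := 1 / 4)
      (by norm_num) 0 0).norm
    refine this.congr (ae_of_all _ fun ξ => ?_)
    simp only [Complex.norm_exp, wt, ← Real.exp_neg]
    congr 1
    rw [zero_mul, add_zero, ← Complex.ofReal_pow, Complex.re_mul_ofReal]
    norm_num
    ring
  refine (hu.integrable_sq.add hG).mono' hu.1 (ae_of_all _ fun ξ => ?_)
  have hw := wt_pos ξ
  have h2 : 2 * ‖u ξ‖ ≤ ‖u ξ‖ ^ 2 * wt ξ + (wt ξ)⁻¹ := by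
    have e : ‖u ξ‖ ^ 2 * wt ξ + (wt ξ)⁻¹ - 2 * ‖u ξ‖ = (‖u ξ‖ * wt ξ - 1) ^ 2 * (wt ξ)⁻¹ := by
      field_simp; ring
    have : 0 ≤ (‖u ξ‖ * wt ξ - 1) ^ 2 * (wt ξ)⁻¹ := by positivity
    linarith
  simp only [Pi.add_apply]
  linarith [norm_nonneg (u ξ)]

end GaussL2

section Decay

variable {f : R2 → ℂ}

lemma GaussianDecay.integrable (hf : ContDiff ℝ (⊤ : ℕ∞) f) (hdec : GaussianDecay f) (k l : ℕ) :
    Integrable fun ξ => ‖ξ‖ ^ (2 * k) * ‖iteratedFDeriv ℝ l f ξ‖ ^ 2 * wt ξ := by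
  have hc : Continuous (iteratedFDeriv ℝ l f) :=
    hf.continuous_iteratedFDeriv (by exact_mod_cast le_top)
  have hw := continuous_wt
  refine ⟨Continuous.aestronglyMeasurable (by fun_prop), ?_⟩
  rw [hasFiniteIntegral_iff_ofReal (ae_of_all _ fun ξ => ?_)]
  · exact hdec k l
  · have := (wt_pos ξ).le
    positivity

lemma GaussianDecay.gaussL2 (hf : ContDiff ℝ (⊤ : ℕ∞) f) (hdec : GaussianDecay f) : GaussL2 f :=
  ⟨hf.continuous.aestronglyMeasurable, fun k => by simpa using hdec.integrable hf k 0⟩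

/-- A continuous function dominated by some `‖D^l f‖` is in `GaussL2`. -/
lemma GaussianDecay.gaussL2_of_le (hf : ContDiff ℝ (⊤ : ℕ∞) f) (hdec : GaussianDecay f) (l : ℕ)
    {v : R2 → ℂ} (hv : Continuous v) (h : ∀ ξ, ‖v ξ‖ ≤ ‖iteratedFDeriv ℝ l f ξ‖) : GaussL2 v := by
  refine ⟨hv.aestronglyMeasurable, fun k => ?_⟩
  have hw := continuous_wt
  refine (hdec.integrable hf k l).mono' (Continuous.aestronglyMeasurable (by fun_prop))
    (ae_of_all _ fun ξ => ?_)
  have := (wt_pos ξ).le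
  rw [Real.norm_of_nonneg (by positivity)]
  gcongr
  exact h ξ

lemma norm_e2 (i : Fin 2) : ‖e2 i‖ = 1 := by simp [e2]

lemma norm_apply_e2_le {E : Type*} [NormedAddCommGroup E] [NormedSpace ℝ E]
    (L : R2 →L[ℝ] E) (i : Fin 2) : ‖L (e2 i)‖ ≤ ‖L‖ := by
  simpa [norm_e2] using L.le_opNorm (e2 i)

lemma GaussianDecay.gaussL2_fderiv (hf : ContDiff ℝ (⊤ : ℕ∞) f) (hdec : GaussianDecay f)
    (i : Fin 2) : GaussL2 fun ξ => fderiv ℝ f ξ (e2 i) :=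
  hdec.gaussL2_of_le hf 1 ((hf.continuous_fderiv (by simp)).clm_apply continuous_const)
    fun ξ => (norm_apply_e2_le _ i).trans_eq (norm_iteratedFDeriv_one f).symm

lemma contDiff_fderiv_apply (hf : ContDiff ℝ (⊤ : ℕ∞) f) (i : Fin 2) :
    ContDiff ℝ (⊤ : ℕ∞) fun ξ => fderiv ℝ f ξ (e2 i) :=
  (hf.fderiv_right (m := (⊤ : ℕ∞)) (by simp)).clm_apply contDiff_const

lemma GaussianDecay.gaussL2_fderiv_fderiv (hf : ContDiff ℝ (⊤ : ℕ∞) f) (hdec : GaussianDecay f)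
    (i : Fin 2) : GaussL2 fun ξ => fderiv ℝ (fun w => fderiv ℝ f w (e2 i)) ξ (e2 i) := by
  refine hdec.gaussL2_of_le hf 2
    (((contDiff_fderiv_apply hf i).continuous_fderiv (by simp)).clm_apply continuous_const)
    fun ξ => ?_
  have hd : DifferentiableAt ℝ (fderiv ℝ f) ξ :=
    (hf.fderiv_right (m := (⊤ : ℕ∞)) (by simp)).differentiable (by simp) ξ
  rw [fderiv_clm_apply hd (differentiableAt_const _), ← norm_iteratedFDeriv_fderiv,
    norm_iteratedFDeriv_one]
  simp only [fderiv_fun_const, Pi.zero_apply, ContinuousLinearMap.comp_zero, zero_add,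
    ContinuousLinearMap.flip_apply]
  exact (norm_apply_e2_le _ i).trans (norm_apply_e2_le _ i)

end Decay

section Energy

/-- The components of `∇f + ξ f / 2 = G ∇(f / G)`. -/
def twistedGrad (f : R2 → ℂ) (i : Fin 2) (ξ : R2) : ℂ :=
  fderiv ℝ f ξ (e2 i) + 1 / 2 * ((ξ i : ℂ) * f ξ)

lemma hasFDerivAt_wt (ξ : R2) :
    HasFDerivAt wt (wt ξ • ((2 : ℝ)⁻¹ • innerSL ℝ ξ)) ξ := by
  have h := ((hasStrictFDerivAt_norm_sq (F := R2) ξ).hasFDerivAt.mul_const (4 : ℝ)⁻¹).exp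
  convert! h using 1
  ext v
  simp [wt, div_eq_mul_inv]
  ring

lemma fderiv_wt_e2 (ξ : R2) (i : Fin 2) : fderiv ℝ wt ξ (e2 i) = ξ i / 2 * wt ξ := by
  rw [(hasFDerivAt_wt ξ).fderiv]
  simp [e2, EuclideanSpace.inner_single_right]
  ring

lemma hasFDerivAt_wtC (ξ : R2) : HasFDerivAt (fun ξ => (wt ξ : ℂ))
    (Complex.ofRealCLM.comp (fderiv ℝ wt ξ)) ξ :=
  Complex.ofRealCLM.hasFDerivAt.comp ξ (hasFDerivAt_wt ξ).differentiableAt.hasFDerivAt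

lemma differentiableAt_mul_wt {u : R2 → ℂ} {ξ : R2} (hu : DifferentiableAt ℝ u ξ) :
    DifferentiableAt ℝ (fun ξ => u ξ * wt ξ) ξ :=
  hu.mul (hasFDerivAt_wtC ξ).differentiableAt

lemma fderiv_mul_wt {u : R2 → ℂ} {ξ : R2} (hu : DifferentiableAt ℝ u ξ) (i : Fin 2) :
    fderiv ℝ (fun ξ => u ξ * wt ξ) ξ (e2 i) = twistedGrad u i ξ * wt ξ := by
  have h : HasFDerivAt (fun ξ => u ξ * wt ξ) _ ξ := hu.hasFDerivAt.mul (hasFDerivAt_wtC ξ)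
  rw [h.fderiv]
  simp only [add_apply, smul_apply,
    ContinuousLinearMap.comp_apply, Complex.ofRealCLM_apply, fderiv_wt_e2, smul_eq_mul, twistedGrad]
  push_cast
  ring

lemma twistedGrad_conj {f : R2 → ℂ} {ξ : R2} (hf : DifferentiableAt ℝ f ξ) (i : Fin 2) :
    twistedGrad (fun ξ => starRingEnd ℂ (f ξ)) i ξ = starRingEnd ℂ (twistedGrad f i ξ) := by
  have h : HasFDerivAt (fun ξ => starRingEnd ℂ (f ξ))
      ((Complex.conjCLE : ℂ →L[ℝ] ℂ).comp (fderiv ℝ f ξ)) ξ :=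
    Complex.conjCLE.hasFDerivAt.comp ξ hf.hasFDerivAt
  simp [twistedGrad, h.fderiv, Complex.conj_ofNat]

variable {f : R2 → ℂ}

lemma fderiv_twistedGrad (hf : ContDiff ℝ (⊤ : ℕ∞) f) (i : Fin 2) (ξ : R2) :
    fderiv ℝ (twistedGrad f i) ξ (e2 i) =
      fderiv ℝ (fun w => fderiv ℝ f w (e2 i)) ξ (e2 i)
        + 1 / 2 * ((ξ i : ℂ) * fderiv ℝ f ξ (e2 i)) + 1 / 2 * f ξ := by
  have h1 := ((contDiff_fderiv_apply hf i).differentiable (by simp) ξ).hasFDerivAt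
  have h2 := (hf.differentiable (by simp) ξ).hasFDerivAt
  have h3 : HasFDerivAt (fun ξ : R2 => (ξ i : ℂ))
      (Complex.ofRealCLM.comp (EuclideanSpace.proj (𝕜 := ℝ) i)) ξ :=
    (Complex.ofRealCLM.comp (EuclideanSpace.proj (𝕜 := ℝ) i)).hasFDerivAt
  have h4 : HasFDerivAt (twistedGrad f i) _ ξ := h1.add ((h3.mul h2).const_mul (1 / 2 : ℂ))
  rw [h4.fderiv]
  simp [e2]
  ring

lemma contDiff_twistedGrad (hf : ContDiff ℝ (⊤ : ℕ∞) f) (i : Fin 2) :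
    ContDiff ℝ (⊤ : ℕ∞) (twistedGrad f i) := by
  have h3 : ContDiff ℝ (⊤ : ℕ∞) fun ξ : R2 => (ξ i : ℂ) :=
    (Complex.ofRealCLM.comp (EuclideanSpace.proj (𝕜 := ℝ) i)).contDiff
  exact (contDiff_fderiv_apply hf i).add (contDiff_const.mul (h3.mul hf))

lemma FP_eq_sum (hf : ContDiff ℝ (⊤ : ℕ∞) f) (ξ : R2) :
    FP f ξ = ∑ i, fderiv ℝ (twistedGrad f i) ξ (e2 i) := by
  have h : fderiv ℝ f ξ ξ = ξ 0 * fderiv ℝ f ξ (e2 0) + ξ 1 * fderiv ℝ f ξ (e2 1) := by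
    conv_lhs => rw [congrArg (fderiv ℝ f ξ) (eq_sum_e2 ξ)]
    simp
  simp only [FP, fderiv_twistedGrad hf, Fin.sum_univ_two, h, Complex.real_smul]
  push_cast
  ring

lemma GaussianDecay.gaussL2_twistedGrad (hf : ContDiff ℝ (⊤ : ℕ∞) f) (hdec : GaussianDecay f)
    (i : Fin 2) : GaussL2 (twistedGrad f i) :=
  (hdec.gaussL2_fderiv hf i).add (((hdec.gaussL2 hf).coord_mul i).const_mul _)

lemma GaussianDecay.gaussL2_fderiv_twistedGrad (hf : ContDiff ℝ (⊤ : ℕ∞) f)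
    (hdec : GaussianDecay f) (i : Fin 2) :
    GaussL2 fun ξ => fderiv ℝ (twistedGrad f i) ξ (e2 i) := by
  simp only [fderiv_twistedGrad hf]
  exact ((hdec.gaussL2_fderiv_fderiv hf i).add
    (((hdec.gaussL2_fderiv hf i).coord_mul i).const_mul _)).add ((hdec.gaussL2 hf).const_mul _)

lemma integral_fderiv_twistedGrad_mul (hf : ContDiff ℝ (⊤ : ℕ∞) f) (hdec : GaussianDecay f)
    (i : Fin 2) :
    ∫ ξ, fderiv ℝ (twistedGrad f i) ξ (e2 i) * (starRingEnd ℂ (f ξ) * wt ξ) =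
      -((∫ ξ, ‖twistedGrad f i ξ‖ ^ 2 * wt ξ : ℝ) : ℂ) := by
  have hfd : Differentiable ℝ f := hf.differentiable (by simp)
  have hcd : Differentiable ℝ fun ξ => starRingEnd ℂ (f ξ) :=
    Complex.conjCLE.differentiable.comp hfd
  have hF := hdec.gaussL2_twistedGrad hf i
  have e : ∀ ξ, twistedGrad f i ξ * fderiv ℝ (fun ξ => starRingEnd ℂ (f ξ) * wt ξ) ξ (e2 i)
      = twistedGrad f i ξ * (starRingEnd ℂ (twistedGrad f i ξ) * wt ξ) := fun ξ => by
    rw [fderiv_mul_wt (hcd ξ), twistedGrad_conj (hfd ξ)]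
  have ibp := integral_mul_fderiv_eq_neg_fderiv_mul_of_integrable (μ := volume)
    (f := twistedGrad f i) (g := fun ξ => starRingEnd ℂ (f ξ) * wt ξ) (v := e2 i)
    ((hdec.gaussL2_fderiv_twistedGrad hf i).integrable_mul (hdec.gaussL2 hf).conj)
    (by simpa only [e] using hF.integrable_mul hF.conj)
    (hF.integrable_mul (hdec.gaussL2 hf).conj)
    (fun ξ _ => (contDiff_twistedGrad hf i).differentiable (by simp) ξ)
    (fun ξ _ => differentiableAt_mul_wt (hcd ξ))
  rw [eq_neg_iff_add_eq_zero, add_comm, ← eq_neg_iff_add_eq_zero, ← ibp, ← integral_complex_ofReal]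
  refine integral_congr_ae (ae_of_all _ fun ξ => ?_)
  simp only [e]
  rw [← mul_assoc, Complex.mul_conj']
  push_cast
  rfl

lemma integral_FP_mul (hf : ContDiff ℝ (⊤ : ℕ∞) f) (hdec : GaussianDecay f) :
    ∫ ξ, FP f ξ * (starRingEnd ℂ (f ξ) * wt ξ) =
      -(((∫ ξ, ‖twistedGrad f 0 ξ‖ ^ 2 * wt ξ) + ∫ ξ, ‖twistedGrad f 1 ξ‖ ^ 2 * wt ξ : ℝ) : ℂ) := by
  have h := fun i => (hdec.gaussL2_fderiv_twistedGrad hf i).integrable_mul (hdec.gaussL2 hf).conj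
  simp only [FP_eq_sum hf, Fin.sum_univ_two, add_mul]
  rw [integral_add (h 0) (h 1), integral_fderiv_twistedGrad_mul hf hdec,
    integral_fderiv_twistedGrad_mul hf hdec]
  push_cast
  ring

lemma GaussianDecay.gaussL2_FP (hf : ContDiff ℝ (⊤ : ℕ∞) f) (hdec : GaussianDecay f) :
    GaussL2 (FP f) := by
  have h : FP f = fun ξ => fderiv ℝ (twistedGrad f 0) ξ (e2 0)
      + fderiv ℝ (twistedGrad f 1) ξ (e2 1) := by
    ext ξ
    rw [FP_eq_sum hf, Fin.sum_univ_two]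
  rw [h]
  exact (hdec.gaussL2_fderiv_twistedGrad hf 0).add (hdec.gaussL2_fderiv_twistedGrad hf 1)

lemma integral_norm_sq_le_of_integral_eq_zero (hf : ContDiff ℝ (⊤ : ℕ∞) f)
    (hdec : GaussianDecay f) (h0 : ∫ ξ, f ξ = 0) :
    ∫ ξ, ‖f ξ‖ ^ 2 * wt ξ ≤
      2 * ((∫ ξ, ‖twistedGrad f 0 ξ‖ ^ 2 * wt ξ) + ∫ ξ, ‖twistedGrad f 1 ξ‖ ^ 2 * wt ξ) := by
  have hfd : Differentiable ℝ f := hf.differentiable (by simp)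
  have hπ : 0 < (4 * π)⁻¹ := by positivity
  have e1 : (fun ξ => Gval ξ • (f ξ * wt ξ)) = fun ξ => (4 * π)⁻¹ • f ξ := by
    ext ξ
    rw [← Gval_mul_wt ξ, Complex.real_smul, Complex.real_smul]
    push_cast
    ring
  have e2' : ∀ u : R2 → ℂ, (fun ξ => Gval ξ * ‖u ξ * wt ξ‖ ^ 2) =
      fun ξ => (4 * π)⁻¹ * (‖u ξ‖ ^ 2 * wt ξ) := fun u => by
    ext ξ
    rw [← Gval_mul_wt ξ, norm_mul, Complex.norm_real, Real.norm_of_nonneg (wt_pos ξ).le]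
    ring
  have hdw : ∀ i, (fun ξ => Gval ξ * ‖fderiv ℝ (fun ξ => f ξ * wt ξ) ξ (e2 i)‖ ^ 2) =
      fun ξ => (4 * π)⁻¹ * (‖twistedGrad f i ξ‖ ^ 2 * wt ξ) := fun i => by
    rw [← e2']
    ext ξ
    rw [fderiv_mul_wt (hfd ξ)]
  have key := poincare_R2 (h := fun ξ => f ξ * wt ξ)
    ((hf.of_le (by simp)).mul (Complex.ofRealCLM.contDiff.comp contDiff_wt))
    (by rw [e1]; exact (hdec.gaussL2 hf).integrable.smul (4 * π)⁻¹)
    (by rw [e2']; exact (hdec.gaussL2 hf).integrable_sq.const_mul _)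
    (by rw [e1, integral_smul, h0, smul_zero])
    (fun i => by rw [hdw]; exact (hdec.gaussL2_twistedGrad hf i).integrable_sq.const_mul _)
  rw [e2', hdw, hdw, integral_const_mul, integral_const_mul, integral_const_mul, ← mul_add,
    mul_left_comm] at key
  exact le_of_mul_le_mul_left key hπ

end Energy

section BiotSavart

lemma integrable_indicator_norm_inv :
    Integrable fun z : R2 => (Set.Iio (1 : ℝ)).indicator (fun r => r⁻¹) ‖z‖ := by
  rw [integrable_fun_norm_addHaar (μ := (volume : Measure R2))
    (f := (Set.Iio (1 : ℝ)).indicator fun r => r⁻¹)]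
  have h : IntegrableOn ((Set.Iio (1 : ℝ)).indicator fun _ => (1 : ℝ)) (Set.Ioi 0) := by
    rw [integrableOn_indicator_iff measurableSet_Iio]
    refine integrableOn_const ?_
    rw [Set.inter_comm, Set.Ioi_inter_Iio]
    simp
  refine h.congr_fun (fun r hr => ?_) measurableSet_Ioi
  have hr' : r ≠ 0 := (Set.mem_Ioi.1 hr).ne'
  by_cases h1 : r ∈ Set.Iio (1 : ℝ) <;> simp [h1, hr']

/-- Integrability of a double integral against a kernel with a `1 / ‖z‖` singularity. -/
lemma integrable_mul_mul_kernel {a b : R2 → ℂ} {k : R2 → ℝ} (ha : Integrable a)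
    (ha2 : Integrable fun ξ => ‖a ξ‖ ^ 2) (hb : Integrable b)
    (hb2 : Integrable fun ξ => ‖b ξ‖ ^ 2) (hk : Measurable k) (hk' : ∀ z, |k z| ≤ ‖z‖⁻¹) :
    Integrable (fun p : R2 × R2 => b p.1 * (a p.2 * k (p.1 - p.2)))
      ((volume : Measure R2).prod volume) := by
  set κ : R2 → ℝ := fun z => (Set.Iio (1 : ℝ)).indicator (fun r => r⁻¹) ‖z‖ with hκ
  have hκi : Integrable κ := integrable_indicator_norm_inv
  have h1 : Integrable (fun p : R2 × R2 => ‖a p.2‖ ^ 2 * κ (p.1 - p.2))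
      ((volume : Measure R2).prod volume) :=
    ha2.convolution_integrand (ContinuousLinearMap.mul ℝ ℝ) hκi
  have h2 : Integrable (fun p : R2 × R2 => ‖b p.1‖ ^ 2 * κ (p.1 - p.2))
      ((volume : Measure R2).prod volume) := by
    have := (hb2.convolution_integrand (ContinuousLinearMap.mul ℝ ℝ) hκi).swap
    refine this.congr (ae_of_all _ fun p => ?_)
    simp [hκ, norm_sub_rev]
  have h3 := hb.norm.mul_prod ha.norm
  refine (h3.add (h1.add h2)).mono' ?_ (ae_of_all _ fun p => ?_)
  · exact (hb.1.comp_fst).mul ((ha.1.comp_snd).mul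
      ((Complex.measurable_ofReal.comp (hk.comp measurable_sub)).aestronglyMeasurable))
  · simp only [norm_mul, Complex.norm_real, Pi.add_apply, Real.norm_eq_abs]
    have hkz := hk' (p.1 - p.2)
    have hA := norm_nonneg (a p.2)
    have hB := norm_nonneg (b p.1)
    have hz := norm_nonneg (p.1 - p.2)
    by_cases hlt : ‖p.1 - p.2‖ < 1
    · have e : κ (p.1 - p.2) = ‖p.1 - p.2‖⁻¹ := by simp [hκ, hlt]
      rw [e]
      calc ‖b p.1‖ * (‖a p.2‖ * |k (p.1 - p.2)|)
          ≤ ‖b p.1‖ * (‖a p.2‖ * ‖p.1 - p.2‖⁻¹) := by gcongr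
        _ = (‖b p.1‖ * ‖a p.2‖) * ‖p.1 - p.2‖⁻¹ := by ring
        _ ≤ (‖a p.2‖ ^ 2 + ‖b p.1‖ ^ 2) * ‖p.1 - p.2‖⁻¹ := by
          gcongr
          nlinarith [sq_nonneg (‖a p.2‖ - ‖b p.1‖)]
        _ ≤ _ := by nlinarith [mul_nonneg hB hA]
    · have e : κ (p.1 - p.2) = 0 := by simp [hκ, not_lt.1 hlt]
      have h4 : |k (p.1 - p.2)| ≤ 1 := hkz.trans (inv_le_one_of_one_le₀ (not_lt.1 hlt))
      rw [e, mul_zero, mul_zero, add_zero, add_zero]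
      gcongr
      exact mul_le_of_le_one_right hA h4

/-- The Biot–Savart kernel. -/
def bsKernel (i : Fin 2) (z : R2) : ℝ :=
  -(2 * π)⁻¹ * ‖z‖ ^ (-(2 : ℝ)) * (v2 (-(z 1)) (z 0)) i

lemma measurable_bsKernel (i : Fin 2) : Measurable (bsKernel i) := by
  have h : Continuous fun z : R2 => v2 (-(z 1)) (z 0) :=
    continuous_v2.comp (f := fun ξ : R2 => (-(ξ 1), ξ 0)) (by fun_prop)
  have h' : Measurable fun z : R2 => (v2 (-(z 1)) (z 0)) i :=
    ((EuclideanSpace.proj (𝕜 := ℝ) i).continuous.comp h).measurable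
  unfold bsKernel
  fun_prop

lemma norm_v2_perp (ξ : R2) : ‖v2 (-(ξ 1)) (ξ 0)‖ = ‖ξ‖ := by
  rw [← sqrt_sq (norm_nonneg _), norm_sq_R2, ← sqrt_sq (norm_nonneg ξ), norm_sq_R2 ξ]
  congr 1
  simp only [v2_zero, v2_one]
  ring

lemma rpow_neg_two_norm (ξ : R2) : ‖ξ‖ ^ (-(2 : ℝ)) = (‖ξ‖ ^ 2)⁻¹ := by
  rw [Real.rpow_neg (norm_nonneg _), Real.rpow_ofNat]

lemma abs_bsKernel_le (i : Fin 2) (z : R2) : |bsKernel i z| ≤ ‖z‖⁻¹ := by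
  have hπ : (2 * π)⁻¹ ≤ 1 := inv_le_one_of_one_le₀ (by linarith [pi_gt_three])
  have h1 : |(v2 (-(z 1)) (z 0)) i| ≤ ‖z‖ := (norm_coord_le _ i).trans_eq (norm_v2_perp z)
  rw [bsKernel, rpow_neg_two_norm, abs_mul, abs_mul, abs_neg, abs_of_nonneg (by positivity),
    abs_of_nonneg (by positivity : 0 ≤ (‖z‖ ^ 2)⁻¹)]
  calc (2 * π)⁻¹ * (‖z‖ ^ 2)⁻¹ * |(v2 (-(z 1)) (z 0)) i|
      ≤ 1 * (‖z‖ ^ 2)⁻¹ * ‖z‖ := by gcongr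
    _ = ‖z‖⁻¹ := by
      rcases eq_or_ne ‖z‖ 0 with h | h
      · simp [h]
      · field_simp

/-- The antisymmetry of the Biot–Savart kernel paired with the position vector. -/
lemma coord_mul_bsKernel_swap (ξ η : R2) :
    η 0 * bsKernel 0 (η - ξ) + η 1 * bsKernel 1 (η - ξ) =
      -(ξ 0 * bsKernel 0 (ξ - η) + ξ 1 * bsKernel 1 (ξ - η)) := by
  simp only [bsKernel, norm_sub_rev η ξ, v2_zero, v2_one, PiLp.sub_apply]
  ring

variable {f : R2 → ℂ}

/-- The two-point density whose integral is the nonlocal part of the quadratic form of `Λ`. -/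
def bsDensity (f : R2 → ℂ) (i : Fin 2) (p : R2 × R2) : ℂ :=
  (p.1 i * starRingEnd ℂ (f p.1)) * (f p.2 * bsKernel i (p.1 - p.2))

lemma GaussL2.integrable_bsDensity (h : GaussL2 f) (i : Fin 2) :
    Integrable (bsDensity f i) ((volume : Measure R2).prod volume) :=
  integrable_mul_mul_kernel h.integrable h.integrable_norm_sq (h.conj.coord_mul i).integrable
    (h.conj.coord_mul i).integrable_norm_sq (measurable_bsKernel i) (abs_bsKernel_le i)

lemma integral_bsDensity_right (ξ : R2) (i : Fin 2) :
    ∫ η, bsDensity f i (ξ, η) = (ξ i * starRingEnd ℂ (f ξ)) * BSvel f ξ i := by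
  simp only [bsDensity, BSvel, bsKernel, integral_const_mul]

lemma re_integral_bsDensity (f : R2 → ℂ) :
    (∫ p, (bsDensity f 0 p + bsDensity f 1 p) ∂((volume : Measure R2).prod volume)).re = 0 := by
  have hs : ∀ p : R2 × R2, bsDensity f 0 p.swap + bsDensity f 1 p.swap =
      -starRingEnd ℂ (bsDensity f 0 p + bsDensity f 1 p) := fun p => by
    have := congrArg (fun x : ℝ => (x : ℂ)) (coord_mul_bsKernel_swap p.1 p.2)
    push_cast at this
    simp only [bsDensity, Prod.fst_swap, Prod.snd_swap, map_add, map_mul, Complex.conj_conj,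
      Complex.conj_ofReal]
    linear_combination (f p.1 * starRingEnd ℂ (f p.2)) * this
  have e := integral_prod_swap (μ := (volume : Measure R2)) (ν := (volume : Measure R2))
    (fun p => bsDensity f 0 p + bsDensity f 1 p)
  simp only [hs] at e
  rw [integral_neg, integral_conj] at e
  have := congrArg Complex.re e
  simp only [Complex.neg_re, Complex.conj_re] at this
  linarith

/-- The nonlocal part of `Λ f`. -/
def nonlocalPart (f : R2 → ℂ) (ξ : R2) : ℂ :=
  BSvel f ξ 0 * ((-(ξ 0) / 2 * Gval ξ : ℝ) : ℂ) + BSvel f ξ 1 * ((-(ξ 1) / 2 * Gval ξ : ℝ) : ℂ)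

lemma nonlocalPart_mul (ξ : R2) : nonlocalPart f ξ * (starRingEnd ℂ (f ξ) * wt ξ) =
    (-(8 * π)⁻¹ : ℝ) * ((∫ η, bsDensity f 0 (ξ, η)) + ∫ η, bsDensity f 1 (ξ, η)) := by
  have hG : (Gval ξ : ℂ) * wt ξ = ((4 * π)⁻¹ : ℝ) := by rw [← Gval_mul_wt ξ]; push_cast; rfl
  have e : (((8 * π)⁻¹ : ℝ) : ℂ) = 1 / 2 * ((4 * π)⁻¹ : ℝ) := by
    push_cast
    ring
  rw [integral_bsDensity_right, integral_bsDensity_right, Complex.ofReal_neg, e, ← hG, nonlocalPart]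
  push_cast
  ring

lemma GaussL2.integrable_nonlocalPart_mul (h : GaussL2 f) :
    Integrable fun ξ => nonlocalPart f ξ * (starRingEnd ℂ (f ξ) * wt ξ) := by
  simp only [nonlocalPart_mul]
  exact ((h.integrable_bsDensity 0).integral_prod_left.add
    (h.integrable_bsDensity 1).integral_prod_left).const_mul _

lemma GaussL2.re_integral_nonlocalPart_mul (h : GaussL2 f) :
    (∫ ξ, nonlocalPart f ξ * (starRingEnd ℂ (f ξ) * wt ξ)).re = 0 := by
  have hre := re_integral_bsDensity f
  rw [integral_add (h.integrable_bsDensity 0) (h.integrable_bsDensity 1),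
    integral_prod _ (h.integrable_bsDensity 0), integral_prod _ (h.integrable_bsDensity 1)] at hre
  simp only [nonlocalPart_mul]
  rw [integral_const_mul, integral_add (h.integrable_bsDensity 0).integral_prod_left
    (h.integrable_bsDensity 1).integral_prod_left, Complex.re_ofReal_mul, hre, mul_zero]

end BiotSavart

section Transport

/-- A radial multiple of the angular derivative of a function integrates to zero. -/
lemma integral_radial_mul_angular_deriv (ρ : ℝ → ℝ) {q : R2 → ℝ} (hq : ContDiff ℝ 1 q) :
    ∫ ξ : R2, ρ ‖ξ‖ * fderiv ℝ q ξ (v2 (-(ξ 1)) (ξ 0)) = 0 := by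
  have hemb : MeasurableEmbedding fun p : ℝ × ℝ => v2 p.1 p.2 :=
    ((MeasurableEquiv.finTwoArrow (α := ℝ)).symm.trans
      (MeasurableEquiv.toLp 2 (Fin 2 → ℝ))).measurableEmbedding
  rw [← measurePreserving_v2_volume.integral_comp hemb,
    ← integral_comp_polarCoord_symm, polarCoord_target]
  by_cases hint : IntegrableOn (fun p : ℝ × ℝ => p.1 • (ρ ‖v2 (polarCoord.symm p).1
      (polarCoord.symm p).2‖ * fderiv ℝ q (v2 (polarCoord.symm p).1 (polarCoord.symm p).2)
      (v2 (-(v2 (polarCoord.symm p).1 (polarCoord.symm p).2 1))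
        (v2 (polarCoord.symm p).1 (polarCoord.symm p).2 0))))
      (Set.Ioi (0 : ℝ) ×ˢ Set.Ioo (-π) π) volume
  swap
  · exact integral_undef hint
  rw [Measure.volume_eq_prod, setIntegral_prod _ (by rwa [← Measure.volume_eq_prod])]
  refine integral_eq_zero_of_ae (ae_of_all _ fun r => ?_)
  have hderiv : ∀ θ : ℝ, HasDerivAt (fun t => q (v2 (r * cos t) (r * sin t)))
      (fderiv ℝ q (v2 (r * cos θ) (r * sin θ)) (v2 (-(r * sin θ)) (r * cos θ))) θ := by
    intro θ
    have h1 : HasDerivAt (fun t => v2 (r * cos t) (r * sin t))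
        (v2 (-(r * sin θ)) (r * cos θ)) θ := by
      have h2 : HasDerivAt (fun t : ℝ => (r * cos t) • e2 0 + (r * sin t) • e2 1)
          ((-(r * sin θ)) • e2 0 + (r * cos θ) • e2 1) θ := by
        refine HasDerivAt.add (HasDerivAt.smul_const ?_ _) (HasDerivAt.smul_const ?_ _)
        · simpa using (hasDerivAt_cos θ).const_mul r
        · simpa using (hasDerivAt_sin θ).const_mul r
      have e : ∀ a b : ℝ, v2 a b = a • e2 0 + b • e2 1 := fun a b => by
        simpa using eq_sum_e2 (v2 a b)
      simpa only [e] using h2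
    exact ((hq.differentiable one_ne_zero _).hasFDerivAt).comp_hasDerivAt θ h1
  have hzero : ∫ θ in Set.Ioo (-π) π,
      fderiv ℝ q (v2 (r * cos θ) (r * sin θ)) (v2 (-(r * sin θ)) (r * cos θ)) = 0 := by
    have hc : Continuous fun θ : ℝ =>
        fderiv ℝ q (v2 (r * cos θ) (r * sin θ)) (v2 (-(r * sin θ)) (r * cos θ)) := by
      refine ((hq.continuous_fderiv one_ne_zero).comp ?_).clm_apply ?_
      · exact continuous_v2.comp (f := fun θ : ℝ => (r * cos θ, r * sin θ)) (by fun_prop)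
      · exact continuous_v2.comp (f := fun θ : ℝ => (-(r * sin θ), r * cos θ)) (by fun_prop)
    rw [← integral_Ioc_eq_integral_Ioo, ← intervalIntegral.integral_of_le (by linarith [pi_pos]),
      intervalIntegral.integral_eq_sub_of_hasDerivAt (fun θ _ => hderiv θ)
        (hc.intervalIntegrable _ _)]
    simp
  have hnorm : ∀ θ : ℝ, ‖v2 (r * cos θ) (r * sin θ)‖ = |r| := fun θ => by
    rw [← sqrt_sq (norm_nonneg _), norm_sq_R2, ← sqrt_sq_eq_abs]
    congr 1
    simp only [v2_zero, v2_one]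
    linear_combination r ^ 2 * sin_sq_add_cos_sq θ
  simp only [polarCoord_symm_apply, v2_zero, v2_one, hnorm, smul_eq_mul, ← mul_assoc,
    Pi.zero_apply]
  rw [integral_const_mul, hzero, mul_zero]

lemma gvec_apply_fderiv {E : Type*} [NormedAddCommGroup E] [NormedSpace ℝ E]
    (L : R2 →L[ℝ] E) (ξ : R2) : L (gvec ξ) =
      ((2 * π)⁻¹ * ‖ξ‖ ^ (-(2 : ℝ)) * (1 - Real.exp (-‖ξ‖ ^ 2 / 4))) •
        L (v2 (-(ξ 1)) (ξ 0)) := by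
  rw [gvec, map_smul]

lemma norm_gvec_le (ξ : R2) : ‖gvec ξ‖ ≤ ‖ξ‖ := by
  rw [gvec, norm_smul, norm_v2_perp]
  refine mul_le_of_le_one_left (norm_nonneg _) ?_
  have h1 : 0 ≤ 1 - Real.exp (-‖ξ‖ ^ 2 / 4) := by
    have : Real.exp (-‖ξ‖ ^ 2 / 4) ≤ 1 := Real.exp_le_one_iff.2 (by nlinarith [sq_nonneg ‖ξ‖])
    linarith
  have h2 : 1 - Real.exp (-‖ξ‖ ^ 2 / 4) ≤ ‖ξ‖ ^ 2 := by
    have := Real.add_one_le_exp (-‖ξ‖ ^ 2 / 4)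
    nlinarith [sq_nonneg ‖ξ‖]
  have hπ : (2 * π)⁻¹ ≤ 1 := inv_le_one_of_one_le₀ (by linarith [pi_gt_three])
  rw [Real.norm_of_nonneg (by positivity), rpow_neg_two_norm, mul_assoc]
  refine mul_le_one₀ hπ (by positivity) ?_
  rw [inv_mul_eq_div]
  exact div_le_one_of_le₀ h2 (by positivity)

variable {f : R2 → ℂ}

lemma GaussianDecay.gaussL2_transport (hf : ContDiff ℝ (⊤ : ℕ∞) f) (hdec : GaussianDecay f) :
    GaussL2 fun ξ => fderiv ℝ f ξ (gvec ξ) := by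
  have hu : GaussL2 fun ξ => (‖fderiv ℝ f ξ‖ : ℂ) :=
    hdec.gaussL2_of_le hf 1 (Complex.continuous_ofReal.comp (hf.continuous_fderiv (by simp)).norm)
      fun ξ => by simp [norm_iteratedFDeriv_one]
  refine hu.of_le ?_ 1 1 fun ξ => ?_
  · have h : Continuous fun ξ : R2 => fderiv ℝ f ξ (v2 (-(ξ 1)) (ξ 0)) :=
      (hf.continuous_fderiv (by simp)).clm_apply
        (continuous_v2.comp (f := fun ξ : R2 => (-(ξ 1), ξ 0)) (by fun_prop))
    simp only [gvec_apply_fderiv]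
    have hc : Measurable fun ξ : R2 =>
        (2 * π)⁻¹ * ‖ξ‖ ^ (-(2 : ℝ)) * (1 - Real.exp (-‖ξ‖ ^ 2 / 4)) := by fun_prop
    exact (hc.smul h.measurable).aestronglyMeasurable
  · rw [Complex.norm_real, norm_norm, one_mul, pow_one, mul_comm]
    exact ((fderiv ℝ f ξ).le_opNorm _).trans (by gcongr; exact norm_gvec_le ξ)

lemma re_integral_transport (hf : ContDiff ℝ (⊤ : ℕ∞) f) (hdec : GaussianDecay f) :
    (∫ ξ, fderiv ℝ f ξ (gvec ξ) * (starRingEnd ℂ (f ξ) * wt ξ)).re = 0 := by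
  have hq : ContDiff ℝ 1 fun ξ => ‖f ξ‖ ^ 2 := (hf.of_le (by simp)).norm_sq ℝ
  rw [← RCLike.re_eq_complex_re, ← integral_re
    ((hdec.gaussL2_transport hf).integrable_mul (hdec.gaussL2 hf).conj)]
  rw [← integral_radial_mul_angular_deriv (fun r => 2⁻¹ *
    (((2 * π)⁻¹ * r ^ (-(2 : ℝ)) * (1 - Real.exp (-r ^ 2 / 4))) * Real.exp (r ^ 2 / 4))) hq]
  refine integral_congr_ae (ae_of_all _ fun ξ => ?_)
  have hd := (hf.differentiable (by simp) ξ).hasFDerivAt.norm_sq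
  beta_reduce
  rw [hd.fderiv, gvec_apply_fderiv]
  simp only [RCLike.re_eq_complex_re, smul_apply,
    ContinuousLinearMap.comp_apply, innerSL_apply_apply, Complex.inner, wt, nsmul_eq_mul]
  generalize fderiv ℝ f ξ (v2 (-(ξ 1)) (ξ 0)) = z
  generalize (2 * π)⁻¹ * ‖ξ‖ ^ (-(2 : ℝ)) * (1 - Real.exp (-‖ξ‖ ^ 2 / 4)) = c
  generalize Real.exp (‖ξ‖ ^ 2 / 4) = w
  simp
  ring

end Transport

lemma spectral_energy_identity (α : ℝ) {f : R2 → ℂ} {lam : ℂ}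
    (hf : ContDiff ℝ (⊤ : ℕ∞) f) (hdec : GaussianDecay f)
    (heig : ∀ ξ : R2, FP f ξ - (α : ℂ) * LambdaOp f ξ = lam * f ξ) :
    lam.re * ∫ ξ, ‖f ξ‖ ^ 2 * wt ξ =
      -((∫ ξ, ‖twistedGrad f 0 ξ‖ ^ 2 * wt ξ) + ∫ ξ, ‖twistedGrad f 1 ξ‖ ^ 2 * wt ξ) := by
  have hL := hdec.gaussL2 hf
  have iF := (hdec.gaussL2_FP hf).integrable_mul hL.conj
  have iT := (hdec.gaussL2_transport hf).integrable_mul hL.conj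
  have iN := hL.integrable_nonlocalPart_mul
  have iTN : Integrable fun ξ => fderiv ℝ f ξ (gvec ξ) * (starRingEnd ℂ (f ξ) * wt ξ)
      - nonlocalPart f ξ * (starRingEnd ℂ (f ξ) * wt ξ) := iT.sub iN
  have hpt : ∀ ξ, lam * ((‖f ξ‖ ^ 2 * wt ξ : ℝ) : ℂ) =
      FP f ξ * (starRingEnd ℂ (f ξ) * wt ξ)
        - α * (fderiv ℝ f ξ (gvec ξ) * (starRingEnd ℂ (f ξ) * wt ξ)
          - nonlocalPart f ξ * (starRingEnd ℂ (f ξ) * wt ξ)) := fun ξ => by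
    have h := heig ξ
    have hL' : LambdaOp f ξ = fderiv ℝ f ξ (gvec ξ) - nonlocalPart f ξ := rfl
    rw [hL'] at h
    have hn := Complex.mul_conj' (f ξ)
    push_cast
    linear_combination (-(starRingEnd ℂ (f ξ)) * wt ξ) * h - lam * wt ξ * hn
  have hint := integral_congr_ae (μ := volume) (ae_of_all _ hpt)
  rw [integral_const_mul, integral_complex_ofReal, integral_sub iF (iTN.const_mul _),
    integral_const_mul, integral_sub iT iN, integral_FP_mul hf hdec] at hint
  have hre := congrArg Complex.re hint
  rwa [Complex.re_mul_ofReal, Complex.sub_re, Complex.re_ofReal_mul, Complex.sub_re,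
    re_integral_transport hf hdec, hL.re_integral_nonlocalPart_mul, sub_zero, mul_zero, sub_zero,
    Complex.neg_re, Complex.ofReal_re] at hre

lemma GaussL2.integral_norm_sq_mul_wt_pos {f : R2 → ℂ} (h : GaussL2 f) (hf : Continuous f)
    (hne : ∃ ξ, f ξ ≠ 0) : 0 < ∫ ξ, ‖f ξ‖ ^ 2 * wt ξ := by
  obtain ⟨ξ, hξ⟩ := hne
  have hw := continuous_wt
  refine integral_pos_of_integrable_nonneg_nonzero (x := ξ) (by fun_prop) h.integrable_sq
    (fun η => mul_nonneg (by positivity) (wt_pos η).le) ?_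
  exact mul_ne_zero (by simpa using hξ) (wt_pos ξ).ne'

theorem spectral_bound_Lambda (α : ℝ) (f : R2 → ℂ) (lam : ℂ)
    (hf : ContDiff ℝ (⊤ : ℕ∞) f) (hdec : GaussianDecay f) (hne : ∃ ξ, f ξ ≠ 0)
    (heig : ∀ ξ : R2, FP f ξ - (α : ℂ) * LambdaOp f ξ = lam * f ξ) :
    lam.re ≤ 0 ∧ ((∫ ξ : R2, f ξ) = 0 → lam.re ≤ -(1/2)) := by
  have hpos := (hdec.gaussL2 hf).integral_norm_sq_mul_wt_pos hf.continuous hne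
  have hE := spectral_energy_identity α hf hdec heig
  have hnn : ∀ i, 0 ≤ ∫ ξ, ‖twistedGrad f i ξ‖ ^ 2 * wt ξ := fun i =>
    integral_nonneg fun ξ => mul_nonneg (by positivity) (wt_pos ξ).le
  refine ⟨?_, fun h0 => ?_⟩
  · by_contra! h
    nlinarith [mul_pos h hpos, hnn 0, hnn 1]
  · have hP := integral_norm_sq_le_of_integral_eq_zero hf hdec h0
    by_contra! h
    nlinarith [mul_pos (sub_pos.2 h) hpos]
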